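/- If (μₙ) is a sequence of unimodular (equivalently, involution invariant) Borel probability measures on Gr converging weakly to a probability measure μ, then μ is unimodular. -/

import Mathlib

open MeasureTheory Filter Topology SimpleGraph ENNReal

/-- A rooted graph: a graph together with a distinguished root vertex. -/
structure RGraph : Type 1 where
  V : Type
  G : SimpleGraph V
  root : V

/-- Rooted graph isomorphism (equality of isomorphism classes). -/
def RGraph.Equiv (X Y : RGraph) : Prop :=
  ∃ e : X.G ≃g Y.G, e X.root = Y.root

/-- The rooted ball of radius `r` around the root. -/
def RGraph.ball (X : RGraph) (r : ℕ) : RGraph where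
  V := ↥{v : X.V | X.G.dist X.root v ≤ r}
  G := X.G.induce {v : X.V | X.G.dist X.root v ≤ r}
  root := ⟨X.root, by simp [SimpleGraph.dist_self]⟩

/-- `α` is a rooted `r`-ball: every vertex is within distance `r` of the root. -/
def RGraph.IsBall (α : RGraph) (r : ℕ) : Prop :=
  ∀ v : α.V, α.G.dist α.root v ≤ r

/-- A rooted graph which is countable, connected and has all degrees `≤ Δ`. -/
structure PRGraph (Δ : ℕ) extends RGraph where
  countable : Countable V
  connected : G.Connected
  degbd : ∀ v : V, (G.neighborSet v).Finite ∧ (G.neighborSet v).ncard ≤ Δ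

def rsetoid (Δ : ℕ) : Setoid (PRGraph Δ) where
  r X Y := X.toRGraph.Equiv Y.toRGraph
  iseqv := by
    constructor
    · intro X
      exact ⟨SimpleGraph.Iso.refl, rfl⟩
    · rintro X Y ⟨e, h⟩
      exact ⟨e.symm, by rw [← h]; exact e.symm_apply_apply _⟩
    · rintro X Y Z ⟨e, he⟩ ⟨f, hf⟩
      exact ⟨e.trans f, by show f (e _) = _; rw [he, hf]⟩

/-- The space of isomorphism classes of countable connected rooted graphs with
degree bound `Δ`. -/
def Gr (Δ : ℕ) := Quotient (rsetoid Δ)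

def mkG {Δ : ℕ} (X : PRGraph Δ) : Gr Δ := Quotient.mk (rsetoid Δ) X

open Classical in
/-- The ultrametric `ρ` on `Gr Δ`. -/
noncomputable def rdist {Δ : ℕ} (q₁ q₂ : Gr Δ) : ℝ :=
  if q₁ = q₂ then 0
  else (2 : ℝ) ^ (-((sSup {t : ℕ | ∃ X Y : PRGraph Δ, q₁ = mkG X ∧ q₂ = mkG Y ∧
    (X.toRGraph.ball t).Equiv (Y.toRGraph.ball t)} : ℕ) : ℤ))

/-- The basic clopen set `T_r(Gr, α)` of classes whose `r`-ball is `α`. -/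
def Tset (Δ r : ℕ) (α : RGraph) : Set (Gr Δ) :=
  {q | ∃ X : PRGraph Δ, q = mkG X ∧ (X.toRGraph.ball r).Equiv α}
/-- A birooted graph: a graph with an ordered pair of distinguished vertices. -/
structure BRGraph : Type 1 where
  V : Type
  G : SimpleGraph V
  root₁ : V
  root₂ : V

/-- Birooted graph isomorphism. -/
def BRGraph.Equiv (X Y : BRGraph) : Prop :=
  ∃ e : X.G ≃g Y.G, e X.root₁ = Y.root₁ ∧ e X.root₂ = Y.root₂

/-- The birooted ball of radius `r` around the first root (always containing the
second root). -/
def BRGraph.ball (X : BRGraph) (r : ℕ) : BRGraph where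
  V := ↥{v : X.V | X.G.dist X.root₁ v ≤ r ∨ v = X.root₂}
  G := X.G.induce {v : X.V | X.G.dist X.root₁ v ≤ r ∨ v = X.root₂}
  root₁ := ⟨X.root₁, Or.inl (by simp [SimpleGraph.dist_self])⟩
  root₂ := ⟨X.root₂, Or.inr rfl⟩

/-- `α` is a birooted `r`-ball: every vertex is within distance `r` of the first root. -/
def BRGraph.IsBall (α : BRGraph) (r : ℕ) : Prop :=
  ∀ v : α.V, α.G.dist α.root₁ v ≤ r

/-- Swapping the two roots of a birooted graph. -/
def BRGraph.swap (X : BRGraph) : BRGraph := ⟨X.V, X.G, X.root₂, X.root₁⟩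

/-- A birooted graph with adjacent roots which is countable, connected and has all
degrees `≤ Δ`. -/
structure BPRGraph (Δ : ℕ) where
  V : Type
  G : SimpleGraph V
  root₁ : V
  root₂ : V
  adj : G.Adj root₁ root₂
  countable : Countable V
  connected : G.Connected
  degbd : ∀ v : V, (G.neighborSet v).Finite ∧ (G.neighborSet v).ncard ≤ Δ

def BPRGraph.toBR {Δ : ℕ} (X : BPRGraph Δ) : BRGraph := ⟨X.V, X.G, X.root₁, X.root₂⟩

def BPRGraph.swap {Δ : ℕ} (X : BPRGraph Δ) : BPRGraph Δ :=
  ⟨X.V, X.G, X.root₂, X.root₁, X.adj.symm, X.countable, X.connected, X.degbd⟩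

def bsetoid (Δ : ℕ) : Setoid (BPRGraph Δ) where
  r X Y := X.toBR.Equiv Y.toBR
  iseqv := by
    constructor
    · intro X
      exact ⟨SimpleGraph.Iso.refl, rfl, rfl⟩
    · rintro X Y ⟨e, h₁, h₂⟩
      exact ⟨e.symm, by rw [← h₁]; exact e.symm_apply_apply _,
        by rw [← h₂]; exact e.symm_apply_apply _⟩
    · rintro X Y Z ⟨e, he₁, he₂⟩ ⟨f, hf₁, hf₂⟩
      exact ⟨e.trans f, by show f (e _) = _; rw [he₁, hf₁],
        by show f (e _) = _; rw [he₂, hf₂]⟩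

/-- The space of isomorphism classes of countable connected birooted graphs with
degree bound `Δ`. -/
def BGr (Δ : ℕ) := Quotient (bsetoid Δ)

def mkB {Δ : ℕ} (X : BPRGraph Δ) : BGr Δ := Quotient.mk (bsetoid Δ) X

open Classical in
/-- The ultrametric `ρ⃗` on `BGr Δ`. -/
noncomputable def brdist {Δ : ℕ} (q₁ q₂ : BGr Δ) : ℝ :=
  if q₁ = q₂ then 0
  else (2 : ℝ) ^ (-((sSup {t : ℕ | ∃ X Y : BPRGraph Δ, q₁ = mkB X ∧ q₂ = mkB Y ∧
    (X.toBR.ball t).Equiv (Y.toBR.ball t)} : ℕ) : ℤ))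

/-- The basic clopen set `T_r(Gr⃗, α⃗)` of birooted classes whose `r`-ball is `α⃗`. -/
def TsetB (Δ r : ℕ) (α : BRGraph) : Set (BGr Δ) :=
  {q | ∃ X : BPRGraph Δ, q = mkB X ∧ (X.toBR.ball r).Equiv α}

/-- The root-swapping involution `ι` on `BGr Δ`. -/
def iota {Δ : ℕ} : BGr Δ → BGr Δ :=
  Quotient.map BPRGraph.swap (by
    rintro X Y ⟨e, h₁, h₂⟩
    exact ⟨e, h₂, h₁⟩)

/-- The birooted graph obtained from a rooted graph and a neighbour of the root. -/
def PRGraph.bi {Δ : ℕ} (X : PRGraph Δ) (x : X.V) (h : X.G.Adj X.root x) : BPRGraph Δ :=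
  ⟨X.V, X.G, X.root, x, h, X.countable, X.connected, X.degbd⟩

/-- `f_A [G,o] = |{x ∈ N_G(o) : [G,o,x] ∈ A}|`, computed on the canonical
representative of the class. -/
noncomputable def fA {Δ : ℕ} (A : Set (BGr Δ)) (q : Gr Δ) : ℕ :=
  Set.ncard {p : (Quotient.out q).G.neighborSet (Quotient.out q).root |
    mkB ((Quotient.out q).bi p.1 p.2) ∈ A}

/-- `[G,o] ↦ Σ_{x ∈ N_G(o)} F [G,o,x]`. -/
noncomputable def outSum {Δ : ℕ} (F : BGr Δ → ℝ≥0∞) (q : Gr Δ) : ℝ≥0∞ :=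
  ∑' p : (Quotient.out q).G.neighborSet (Quotient.out q).root,
    F (mkB ((Quotient.out q).bi p.1 p.2))

/-- `[G,o] ↦ Σ_{x ∈ N_G(o)} F [G,x,o]`. -/
noncomputable def inSum {Δ : ℕ} (F : BGr Δ → ℝ≥0∞) (q : Gr Δ) : ℝ≥0∞ :=
  ∑' p : (Quotient.out q).G.neighborSet (Quotient.out q).root,
    F (mkB (((Quotient.out q).bi p.1 p.2).swap))

/-- Unimodularity of a measure on `Gr Δ`. -/
def Unimodular {Δ : ℕ} [MeasurableSpace (Gr Δ)] [MeasurableSpace (BGr Δ)]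
    (μ : Measure (Gr Δ)) : Prop :=
  ∀ F : BGr Δ → ℝ≥0∞, Measurable F →
    ∫⁻ q, inSum F q ∂μ = ∫⁻ q, outSum F q ∂μ

/-- The kernel sending `[G,o]` to `Σ_{x ∈ N_G(o)} δ_{[G,o,x]}`. -/
noncomputable def edgeKer {Δ : ℕ} [MeasurableSpace (BGr Δ)] (q : Gr Δ) :
    Measure (BGr Δ) :=
  haveI : Countable (Quotient.out q).V := (Quotient.out q).countable
  Measure.sum (fun p : (Quotient.out q).G.neighborSet (Quotient.out q).root =>
    Measure.dirac (mkB ((Quotient.out q).bi p.1 p.2)))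

/-- The edge measure `ν⃗` on `BGr Δ` associated to a measure `ν` on `Gr Δ`:
`ν⃗(A) = ∫ |{x ∈ N_G(o) : [G,o,x] ∈ A}| dν[G,o]`. -/
noncomputable def vecM {Δ : ℕ} [MeasurableSpace (Gr Δ)] [MeasurableSpace (BGr Δ)]
    (ν : Measure (Gr Δ)) : Measure (BGr Δ) :=
  ν.bind edgeKer

/-- Weak convergence of a sequence of Borel measures. -/
def WeakConv {α : Type*} [TopologicalSpace α] [MeasurableSpace α]
    (μn : ℕ → Measure α) (μ : Measure α) : Prop :=
  ∀ f : α → ℝ, Continuous f →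
    Tendsto (fun n => ∫ x, f x ∂(μn n)) atTop (𝓝 (∫ x, f x ∂μ))
/-- The connected component of `x` in a finite graph `G` with degree bound `Δ`,
viewed as a rooted graph with root `x`. -/
noncomputable def compPR {V : Type} [Fintype V] (G : SimpleGraph V) {Δ : ℕ}
    (hdeg : ∀ v : V, (G.neighborSet v).ncard ≤ Δ) (x : V) : PRGraph Δ where
  V := ↥{y : V | G.Reachable x y}
  G := G.induce {y : V | G.Reachable x y}
  root := ⟨x, ⟨Walk.nil⟩⟩
  countable := by infer_instance
  connected := by
    classical
    apply SimpleGraph.induce_connected_of_patches x (by exact ⟨Walk.nil⟩)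
    intro v hv
    obtain ⟨p⟩ := hv
    refine ⟨{w | w ∈ p.support}, ?_, p.start_mem_support, p.end_mem_support, ?_⟩
    · intro w hw
      exact ⟨(p.takeUntil w hw)⟩
    · exact (p.connected_induce_support _ _)
  degbd := by
    intro v
    constructor
    · exact Set.toFinite _
    · have himg : Subtype.val '' ((G.induce {y : V | G.Reachable x y}).neighborSet v)
          ⊆ G.neighborSet v.1 := by
        rintro _ ⟨w, hw, rfl⟩
        exact hw
      calc ((G.induce {y : V | G.Reachable x y}).neighborSet v).ncard
          = (Subtype.val '' ((G.induce {y : V | G.Reachable x y}).neighborSet v)).ncard :=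
            (Set.ncard_image_of_injective _ Subtype.val_injective).symm
        _ ≤ (G.neighborSet v.1).ncard := Set.ncard_le_ncard himg (Set.toFinite _)
        _ ≤ Δ := hdeg v.1

/-- The law `Ψ(G)` of a finite graph `G`: the distribution of the rooted connected
component `[G_o, o]` of a uniformly random vertex `o`. -/
noncomputable def law {V : Type} [Fintype V] (G : SimpleGraph V) {Δ : ℕ}
    (hdeg : ∀ v : V, (G.neighborSet v).ncard ≤ Δ) [MeasurableSpace (Gr Δ)] :
    Measure (Gr Δ) :=
  (Fintype.card V : ℝ≥0∞)⁻¹ • ∑ x : V, Measure.dirac (mkG (compPR G hdeg x))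

/-- Every vertex lies within distance `r` of the first root or is the second root. -/
def BRGraph.Within (X : BRGraph) (r : ℕ) : Prop :=
  ∀ v : X.V, X.G.dist X.root₁ v ≤ r ∨ v = X.root₂

theorem BRGraph.Equiv.symm {X Y : BRGraph} (h : X.Equiv Y) : Y.Equiv X := by
  obtain ⟨e, h₁, h₂⟩ := h
  exact ⟨e.symm, by rw [← h₁]; exact e.symm_apply_apply _,
    by rw [← h₂]; exact e.symm_apply_apply _⟩

theorem BRGraph.Equiv.trans {X Y Z : BRGraph} (h : X.Equiv Y) (h' : Y.Equiv Z) : X.Equiv Z := by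
  obtain ⟨e, h₁, h₂⟩ := h
  obtain ⟨f, h₃, h₄⟩ := h'
  exact ⟨e.trans f, by show f (e _) = _; rw [h₁, h₃], by show f (e _) = _; rw [h₂, h₄]⟩

theorem RGraph.Equiv.symm {X Y : RGraph} (h : X.Equiv Y) : Y.Equiv X := by
  obtain ⟨e, h₁⟩ := h
  exact ⟨e.symm, by rw [← h₁]; exact e.symm_apply_apply _⟩

theorem RGraph.Equiv.trans {X Y Z : RGraph} (h : X.Equiv Y) (h' : Y.Equiv Z) : X.Equiv Z := by
  obtain ⟨e, h₁⟩ := h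
  obtain ⟨f, h₃⟩ := h'
  exact ⟨e.trans f, by show f (e _) = _; rw [h₁, h₃]⟩

theorem mkB_eq {Δ : ℕ} {X Y : BPRGraph Δ} : mkB X = mkB Y ↔ X.toBR.Equiv Y.toBR :=
  Quotient.eq (r := bsetoid Δ)

theorem mkG_eq {Δ : ℕ} {X Y : PRGraph Δ} : mkG X = mkG Y ↔ X.toRGraph.Equiv Y.toRGraph :=
  Quotient.eq (r := rsetoid Δ)

theorem mkG_out {Δ : ℕ} (q : Gr Δ) : mkG (Quotient.out q) = q := Quotient.out_eq q

section Graph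

variable {V W : Type} {G : SimpleGraph V} {H : SimpleGraph W}

theorem dist_map_le (f : G →g H) {x y : V} (p : G.Walk x y) : H.dist (f x) (f y) ≤ p.length :=
  (dist_le (p.map f)).trans (Walk.length_map f p).le

/-- A graph isomorphism preserves distances. -/
theorem dist_iso (e : G ≃g H) (hG : G.Connected) (x y : V) : H.dist (e x) (e y) = G.dist x y := by
  have key : ∀ {V W : Type} {G : SimpleGraph V} {H : SimpleGraph W} (e : G ≃g H)
      (_ : G.Connected) (x y : V), H.dist (e x) (e y) ≤ G.dist x y := by
    intro V W G H e hG x y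
    obtain ⟨p, hp⟩ := hG.exists_walk_length_eq_dist x y
    rw [← hp]
    exact dist_map_le e.toHom p
  refine le_antisymm (key e hG x y) ?_
  have := key e.symm (e.connected_iff.1 hG) (e x) (e y)
  rwa [e.symm_apply_apply, e.symm_apply_apply] at this

/-- A shortest walk issued from `x` stays in a set containing the ball around `x`. -/
theorem exists_walk_induce (hG : G.Connected) {S : Set V} {x : S} {r : ℕ}
    (hS : ∀ v, G.dist x v ≤ r → v ∈ S) (v : S) (hv : G.dist x v ≤ r) :
    ∃ p : (G.induce S).Walk x v, p.length ≤ r := by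
  classical
  obtain ⟨p, hp⟩ := hG.exists_walk_length_eq_dist x.1 v.1
  have hs : ∀ w ∈ p.support, w ∈ S := fun w hw =>
    hS w ((dist_le (p.takeUntil w hw)).trans ((p.length_takeUntil_le_length hw).trans (hp.le.trans hv)))
  refine ⟨p.induce S hs, ?_⟩
  have h := congrArg Walk.length (Walk.map_induce p hs)
  rw [Walk.length_map] at h
  have h' : (p.induce S hs).length = p.length := h
  rw [h', hp]
  exact hv

theorem dist_le_of_induce_iso (hG : G.Connected) {S : Set V} {T : Set W}
    (e : G.induce S ≃g H.induce T) {x : S} {r : ℕ} (hS : ∀ v, G.dist x v ≤ r → v ∈ S) (v : S)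
    (hv : G.dist x v ≤ r) : H.dist (e x) (e v) ≤ r := by
  obtain ⟨p, hp⟩ := exists_walk_induce hG hS v hv
  exact (dist_map_le ((Embedding.induce T).toHom.comp e.toHom) p).trans hp

/-- Isomorphisms of induced subgraphs preserve balls that are included in the vertex sets. -/
theorem dist_le_iff_of_induce_iso (hG : G.Connected) (hH : H.Connected) {S : Set V} {T : Set W}
    (e : G.induce S ≃g H.induce T) {x : S} {r : ℕ} (hS : ∀ v, G.dist x v ≤ r → v ∈ S)
    (hT : ∀ v, H.dist (e x) v ≤ r → v ∈ T) (v : S) :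
    H.dist (e x) (e v) ≤ r ↔ G.dist x v ≤ r := by
  refine ⟨fun h => ?_, dist_le_of_induce_iso hG e hS v⟩
  have := dist_le_of_induce_iso hH e.symm hT (e v) h
  rwa [e.symm_apply_apply, e.symm_apply_apply] at this

/-- Restriction of an isomorphism of induced subgraphs to smaller induced subgraphs. -/
def restrictIso {S S' : Set V} {T T' : Set W} (e : G.induce S ≃g H.induce T)
    (hS : S' ⊆ S) (hT : T' ⊆ T) (h : ∀ v : S, (e v).1 ∈ T' ↔ v.1 ∈ S') :
    G.induce S' ≃g H.induce T' where
  toFun v := ⟨(e ⟨v.1, hS v.2⟩).1, (h _).2 v.2⟩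
  invFun w := ⟨(e.symm ⟨w.1, hT w.2⟩).1, (h _).1 (by rw [e.apply_symm_apply]; exact w.2)⟩
  left_inv v := by
    simp
  right_inv w := by
    simp
  map_rel_iff' {v w} := e.map_rel_iff' (a := ⟨v.1, hS v.2⟩) (b := ⟨w.1, hS w.2⟩)

/-- A connected graph without vertices at distance `r + 1` from `x` is a ball of radius `r`. -/
theorem dist_le_of_forall_ne (hG : G.Connected) (x : V) (r : ℕ)
    (h : ∀ v, G.dist x v ≠ r + 1) (v : V) : G.dist x v ≤ r := by
  obtain ⟨p⟩ := hG x v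
  induction p using Walk.concatRec with
  | Hnil => simp
  | Hconcat p hadj ih =>
    rename_i u v w
    have h1 := hG.dist_triangle (u := u) (v := v) (w := w)
    have h2 : G.dist v w = 1 := dist_eq_one_iff_adj.2 hadj
    have h3 := h w
    have h4 := ih h
    omega

end Graph

/-- Isomorphic rooted graphs have isomorphic balls. -/
theorem RGraph.Equiv.ball {X Y : RGraph} (h : X.Equiv Y) (hX : X.G.Connected) (r : ℕ) :
    (X.ball r).Equiv (Y.ball r) := by
  obtain ⟨e, he⟩ := h
  have hd : ∀ v, Y.G.dist Y.root (e v) = X.G.dist X.root v := fun v => by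
    rw [← he, dist_iso e hX]
  refine ⟨⟨e.toEquiv.subtypeEquiv fun v => ?_, ?_⟩, ?_⟩
  · show _ ↔ Y.G.dist Y.root (e v) ≤ r
    rw [hd]; rfl
  · intro a b
    exact e.map_rel_iff' (a := a.1) (b := b.1)
  · exact Subtype.ext he

theorem BRGraph.Equiv.ball {X Y : BRGraph} (h : X.Equiv Y) (hX : X.G.Connected) (r : ℕ) :
    (X.ball r).Equiv (Y.ball r) := by
  obtain ⟨e, he, he'⟩ := h
  have hd : ∀ v, Y.G.dist Y.root₁ (e v) = X.G.dist X.root₁ v := fun v => by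
    rw [← he, dist_iso e hX]
  refine ⟨⟨e.toEquiv.subtypeEquiv fun v => ?_, ?_⟩, ?_⟩
  · show _ ↔ Y.G.dist Y.root₁ (e v) ≤ r ∨ e v = Y.root₂
    rw [hd, ← he', e.injective.eq_iff]; rfl
  · intro a b
    exact e.map_rel_iff' (a := a.1) (b := b.1)
  · exact ⟨Subtype.ext he, Subtype.ext he'⟩

/-- An isomorphism of induced subgraphs induces isomorphisms of the birooted balls that are
included in the vertex sets. -/
theorem BRGraph.ball_equiv_of_induce_iso {V W : Type} {G : SimpleGraph V} {H : SimpleGraph W}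
    (hG : G.Connected) (hH : H.Connected) {S : Set V} {T : Set W}
    (e : G.induce S ≃g H.induce T) {x y : S} {x' y' : W} (hx : (e x).1 = x') (hy : (e y).1 = y')
    {r : ℕ} (hS : ∀ v, G.dist x v ≤ r → v ∈ S) (hT : ∀ v, H.dist x' v ≤ r → v ∈ T) :
    (BRGraph.ball ⟨V, G, x, y⟩ r).Equiv (BRGraph.ball ⟨W, H, x', y'⟩ r) := by
  subst hx hy
  refine ⟨restrictIso (S' := {v | G.dist x v ≤ r ∨ v = y})
    (T' := {v | H.dist (e x) v ≤ r ∨ v = e y}) e ?_ ?_ ?_, rfl, rfl⟩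
  · rintro v (hv | rfl)
    exacts [hS v hv, y.2]
  · rintro v (hv | rfl)
    exacts [hT v hv, (e y).2]
  · intro v
    exact or_congr (dist_le_iff_of_induce_iso hG hH e hS hT v)
      (Subtype.ext_iff.symm.trans (e.injective.eq_iff.trans Subtype.ext_iff))

/-- Isomorphisms of balls restrict to smaller balls. -/
theorem BRGraph.ball_equiv_mono {X Y : BRGraph} (hX : X.G.Connected) (hY : Y.G.Connected)
    {r t : ℕ} (hrt : r ≤ t) (h : (X.ball t).Equiv (Y.ball t)) : (X.ball r).Equiv (Y.ball r) := by
  obtain ⟨e, he, he'⟩ := h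
  exact ball_equiv_of_induce_iso (S := {v : X.V | X.G.dist X.root₁ v ≤ t ∨ v = X.root₂})
    (T := {v : Y.V | Y.G.dist Y.root₁ v ≤ t ∨ v = Y.root₂}) hX hY e
    (congrArg Subtype.val he) (congrArg Subtype.val he')
    (fun v hv => Or.inl (hv.trans hrt)) (fun v hv => Or.inl (hv.trans hrt))

theorem BRGraph.ball_equiv_self {X : BRGraph} {r : ℕ} (h : X.Within r) : (X.ball r).Equiv X := by
  refine ⟨⟨Equiv.subtypeUnivEquiv h, ?_⟩, rfl, rfl⟩
  intro a b
  exact Iff.rfl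

theorem BRGraph.Within.mono {X : BRGraph} {r t : ℕ} (h : X.Within r) (hrt : r ≤ t) :
    X.Within t := fun v => (h v).imp (fun h => h.trans hrt) id

theorem BRGraph.within_ball {X : BRGraph} (hX : X.G.Connected) (r : ℕ) : (X.ball r).Within r := by
  rintro ⟨v, hv | hv⟩
  · left
    obtain ⟨p, hp⟩ := exists_walk_induce (S := {v : X.V | X.G.dist X.root₁ v ≤ r ∨ v = X.root₂})
      (x := ⟨X.root₁, Or.inl (by simp)⟩) hX (fun v hv => Or.inl hv) ⟨v, Or.inl hv⟩ hv
    exact (dist_le p).trans hp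
  · right
    exact Subtype.ext hv

namespace BPRGraph

variable {Δ : ℕ}

theorem dist_root₂ (X : BPRGraph Δ) : X.G.dist X.root₁ X.root₂ = 1 := dist_eq_one_iff_adj.2 X.adj

/-- The ball of radius `r`, as an element of the space of birooted graphs. -/
def trunc (X : BPRGraph Δ) (r : ℕ) : BPRGraph Δ where
  V := (X.toBR.ball r).V
  G := (X.toBR.ball r).G
  root₁ := (X.toBR.ball r).root₁
  root₂ := (X.toBR.ball r).root₂
  adj := X.adj
  countable := by
    have := X.countable
    exact Subtype.countable (p := fun v : X.V => X.G.dist X.root₁ v ≤ r ∨ v = X.root₂)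
  connected := by
    rw [connected_iff_exists_forall_reachable]
    refine ⟨(X.toBR.ball r).root₁, ?_⟩
    rintro ⟨v, hv | hv⟩
    · obtain ⟨p, -⟩ := exists_walk_induce
        (S := {v : X.V | X.G.dist X.root₁ v ≤ r ∨ v = X.root₂})
        (x := ⟨X.root₁, Or.inl (by simp)⟩) X.connected (fun v hv => Or.inl hv) ⟨v, Or.inl hv⟩ hv
      exact ⟨p⟩
    · change v = X.root₂ at hv
      subst hv
      exact Adj.reachable X.adj
  degbd := by
    intro v
    have h1 : Set.InjOn Subtype.val ((X.toBR.ball r).G.neighborSet v) :=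
      Subtype.val_injective.injOn
    have h2 : Set.MapsTo Subtype.val ((X.toBR.ball r).G.neighborSet v) (X.G.neighborSet v.1) :=
      fun w hw => hw
    have h3 := X.degbd v.1
    exact ⟨Set.Finite.of_injOn h2 h1 h3.1, (Set.ncard_le_ncard_of_injOn _ h2 h1 h3.1).trans h3.2⟩

/-- A birooted graph of radius at most `r` is determined by its ball of radius `r + 1`. -/
theorem equiv_of_ball_succ {X Z : BPRGraph Δ} {r : ℕ} (hr : 1 ≤ r) (hZ : Z.toBR.Within r)
    (h : (Z.toBR.ball (r + 1)).Equiv (X.toBR.ball (r + 1))) : Z.toBR.Equiv X.toBR := by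
  have hZX := (BRGraph.ball_equiv_self (hZ.mono r.le_succ)).symm.trans h
  obtain ⟨e, he, he'⟩ := hZX
  have he1 : (e Z.root₁).1 = X.root₁ := congrArg Subtype.val he
  have hX : ∀ v, X.G.dist X.root₁ v ≤ r := by
    refine dist_le_of_forall_ne X.connected _ _ fun v hv => ?_
    obtain ⟨z, hz⟩ := e.surjective ⟨v, Or.inl hv.le⟩
    have hdz : Z.G.dist Z.root₁ z ≤ r := by
      rcases hZ z with h | h
      · exact h
      · rw [h]
        exact Z.dist_root₂.le.trans hr
    obtain ⟨p, hp⟩ := Z.connected.exists_walk_length_eq_dist Z.root₁ z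
    have := (dist_map_le ((Embedding.induce
      {v : X.V | X.G.dist X.root₁ v ≤ r + 1 ∨ v = X.root₂}).toHom.comp e.toHom) p).trans hp.le
    change X.G.dist (e Z.root₁).1 (e z).1 ≤ _ at this
    rw [he1, hz] at this
    change X.G.dist X.root₁ v ≤ _ at this
    omega
  exact (BRGraph.Equiv.trans ⟨e, he, he'⟩
    (BRGraph.ball_equiv_self fun v => Or.inl ((hX v).trans r.le_succ)))

variable [MetricSpace (BGr Δ)]

theorem dist_le_of_within (hbdist : ∀ a b : BGr Δ, dist a b = brdist a b) {X Z : BPRGraph Δ}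
    {r : ℕ} (hr : 1 ≤ r) (hZ : Z.toBR.Within r) (h : (Z.toBR.ball r).Equiv (X.toBR.ball r)) :
    dist (mkB Z) (mkB X) ≤ (1 / 2) ^ r := by
  classical
  rw [hbdist, brdist]
  split_ifs with hne
  · positivity
  set S := {t : ℕ | ∃ X' Y' : BPRGraph Δ, mkB Z = mkB X' ∧ mkB X = mkB Y' ∧
    (X'.toBR.ball t).Equiv (Y'.toBR.ball t)} with hS
  have hbdd : BddAbove S := by
    refine ⟨r, fun t ht => ?_⟩
    by_contra hlt
    obtain ⟨X', Y', hX', hY', ht⟩ := ht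
    have h1 := (BRGraph.Equiv.ball (mkB_eq.1 hX') Z.connected t).trans
      (ht.trans (BRGraph.Equiv.ball (mkB_eq.1 hY') X.connected t).symm)
    exact hne (mkB_eq.2 (equiv_of_ball_succ hr hZ
      (BRGraph.ball_equiv_mono Z.connected X.connected (by omega) h1)))
  have hle : r ≤ sSup S := le_csSup hbdd ⟨Z, X, rfl, rfl, h⟩
  rw [zpow_neg, zpow_natCast, one_div, inv_pow]
  exact inv_anti₀ (by positivity) (pow_le_pow_right₀ (by norm_num) hle)

/-- Birooted graphs with isomorphic large balls are close. -/
theorem dist_le_of_ball_equiv (hbdist : ∀ a b : BGr Δ, dist a b = brdist a b)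
    {X Y : BPRGraph Δ} {r : ℕ} (hr : 1 ≤ r) (h : (X.toBR.ball r).Equiv (Y.toBR.ball r)) :
    dist (mkB X) (mkB Y) ≤ 2 * (1 / 2) ^ r := by
  have hw : (X.trunc r).toBR.Within r := BRGraph.within_ball X.connected r
  have h0 : ((X.trunc r).toBR.ball r).Equiv (X.toBR.ball r) := BRGraph.ball_equiv_self hw
  have h1 := dist_le_of_within hbdist hr hw h0
  have h2 := dist_le_of_within hbdist hr hw (h0.trans h)
  have h3 := dist_triangle_left (mkB X) (mkB Y) (mkB (X.trunc r))
  linarith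

end BPRGraph

/-- Close rooted graphs have isomorphic large balls. -/
theorem ball_equiv_of_dist_lt {Δ : ℕ} [MetricSpace (Gr Δ)]
    (hdist : ∀ a b : Gr Δ, dist a b = rdist a b) {X Y : PRGraph Δ} {r : ℕ}
    (h : dist (mkG X) (mkG Y) < (1 / 2) ^ r) :
    ∃ t, r ≤ t ∧ (X.toRGraph.ball t).Equiv (Y.toRGraph.ball t) := by
  classical
  rw [hdist, rdist] at h
  split_ifs at h with hne
  · exact ⟨r, le_rfl, RGraph.Equiv.ball (mkG_eq.1 hne) X.connected r⟩
  set S := {t : ℕ | ∃ X' Y' : PRGraph Δ, mkG X = mkG X' ∧ mkG Y = mkG Y' ∧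
    (X'.toRGraph.ball t).Equiv (Y'.toRGraph.ball t)} with hS
  rw [zpow_neg, zpow_natCast, one_div, inv_pow, inv_lt_inv₀ (by positivity) (by positivity)] at h
  have hlt : r < sSup S := (pow_lt_pow_iff_right₀ (by norm_num)).1 h
  have hne : S.Nonempty := by
    by_contra hS
    rw [Set.not_nonempty_iff_eq_empty] at hS
    simp [hS] at hlt
  have hbdd : BddAbove S := by
    by_contra hS
    rw [csSup_of_not_bddAbove hS] at hlt
    simp at hlt
  obtain ⟨X', Y', hX', hY', ht⟩ := Nat.sSup_mem hne hbdd
  exact ⟨_, hlt.le, (RGraph.Equiv.ball (mkG_eq.1 hX') X.connected _).trans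
      (ht.trans (RGraph.Equiv.ball (mkG_eq.1 hY') Y.connected _).symm)⟩

/-- An isomorphism between balls induces a bijection between the neighbours of the roots which
preserves the isomorphism classes of the smaller birooted balls, for both orders of the roots. -/
theorem exists_neighborSet_equiv {Δ : ℕ} {X Y : PRGraph Δ} {r t : ℕ} (hrt : r + 1 ≤ t)
    (h : (X.toRGraph.ball t).Equiv (Y.toRGraph.ball t)) :
    ∃ σ : X.G.neighborSet X.root ≃ Y.G.neighborSet Y.root, ∀ p,
      ((X.bi p.1 p.2).toBR.ball r).Equiv ((Y.bi (σ p).1 (σ p).2).toBR.ball r) ∧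
      ((X.bi p.1 p.2).swap.toBR.ball r).Equiv ((Y.bi (σ p).1 (σ p).2).swap.toBR.ball r) := by
  obtain ⟨e, he⟩ := h
  change X.G.induce {v : X.V | X.G.dist X.root v ≤ t} ≃g
    Y.G.induce {v : Y.V | Y.G.dist Y.root v ≤ t} at e
  have hadj : ∀ {Z : PRGraph Δ} {x : Z.V}, Z.G.Adj Z.root x → Z.G.dist Z.root x ≤ t :=
    fun hx => (dist_eq_one_iff_adj.2 hx).le.trans (by omega)
  have hball : ∀ {Z : PRGraph Δ} {x v : Z.V}, Z.G.Adj Z.root x → Z.G.dist x v ≤ r →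
      Z.G.dist Z.root v ≤ t := fun {Z x v} hx hv => by
    have h1 := Z.connected.dist_triangle (u := Z.root) (v := x) (w := v)
    have h2 := dist_eq_one_iff_adj.2 hx
    omega
  let o : {v : X.V | X.G.dist X.root v ≤ t} := ⟨X.root, by simp⟩
  let o' : {v : Y.V | Y.G.dist Y.root v ≤ t} := ⟨Y.root, by simp⟩
  have ho : e o = o' := he
  have hto : ∀ v, X.G.Adj X.root v.1 ↔ Y.G.Adj Y.root (e v).1 := fun v => by
    have := e.map_adj_iff (v := o) (w := v)
    rw [ho] at this
    exact this.symm
  let σ : X.G.neighborSet X.root ≃ Y.G.neighborSet Y.root :=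
    { toFun := fun p => ⟨(e ⟨p.1, hadj p.2⟩).1, (hto _).1 p.2⟩
      invFun := fun p => ⟨(e.symm ⟨p.1, hadj p.2⟩).1,
        (hto _).2 (by rw [e.apply_symm_apply]; exact p.2)⟩
      left_inv := fun p => by simp
      right_inv := fun p => by simp }
  refine ⟨σ, fun p => ⟨?_, ?_⟩⟩
  · refine BRGraph.ball_equiv_of_induce_iso X.connected Y.connected e (x := o)
      (y := ⟨p.1, hadj p.2⟩) (congrArg Subtype.val ho) rfl ?_ ?_
    · exact fun v hv => hv.trans (by omega)
    · exact fun v hv => hv.trans (by omega)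
  · refine BRGraph.ball_equiv_of_induce_iso X.connected Y.connected e (y := o)
      (x := ⟨p.1, hadj p.2⟩) rfl (congrArg Subtype.val ho) ?_ ?_
    · exact fun v hv => hball p.2 hv
    · exact fun v hv => hball (σ p).2 hv

/-- A map of birooted graphs compatible with isomorphisms of balls around the root of the
underlying rooted graph. -/
def IsLocal {Δ : ℕ} (φ : BPRGraph Δ → BPRGraph Δ) : Prop :=
  ∀ (X Y : PRGraph Δ) (r t : ℕ), r + 1 ≤ t → (X.toRGraph.ball t).Equiv (Y.toRGraph.ball t) →
    ∃ σ : X.G.neighborSet X.root ≃ Y.G.neighborSet Y.root, ∀ p,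
      ((φ (X.bi p.1 p.2)).toBR.ball r).Equiv ((φ (Y.bi (σ p).1 (σ p).2)).toBR.ball r)

theorem isLocal_id {Δ : ℕ} : IsLocal (id : BPRGraph Δ → BPRGraph Δ) := fun X Y r t hrt h => by
  obtain ⟨σ, hσ⟩ := exists_neighborSet_equiv hrt h
  exact ⟨σ, fun p => (hσ p).1⟩

theorem isLocal_swap {Δ : ℕ} : IsLocal (BPRGraph.swap : BPRGraph Δ → BPRGraph Δ) :=
  fun X Y r t hrt h => by
    obtain ⟨σ, hσ⟩ := exists_neighborSet_equiv hrt h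
    exact ⟨σ, fun p => (hσ p).2⟩

section Kernel

variable {Δ : ℕ}

/-- The sum of `F` over the classes of `φ (G, o, x)`, for `x` a neighbour of the root `o`. -/
noncomputable def nbrSum (φ : BPRGraph Δ → BPRGraph Δ) (F : BGr Δ → ℝ≥0∞) (q : Gr Δ) : ℝ≥0∞ :=
  ∑' p : (Quotient.out q).G.neighborSet (Quotient.out q).root,
    F (mkB (φ ((Quotient.out q).bi p.1 p.2)))

theorem tsum_neighborSet_le (X : PRGraph Δ) (f : X.G.neighborSet X.root → ℝ≥0∞) (C : ℝ≥0∞)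
    (hf : ∀ p, f p ≤ C) : ∑' p, f p ≤ Δ * C := by
  have := (X.degbd X.root).1.fintype
  rw [tsum_fintype]
  refine (Finset.sum_le_card_nsmul _ _ C fun p _ => hf p).trans ?_
  rw [nsmul_eq_mul, Finset.card_univ, ← Nat.card_eq_fintype_card]
  gcongr
  exact (X.degbd X.root).2

theorem nbrSum_le (φ : BPRGraph Δ → BPRGraph Δ) {F : BGr Δ → ℝ≥0∞} {C : ℝ≥0∞}
    (hF : ∀ b, F b ≤ C) (q : Gr Δ) : nbrSum φ F q ≤ Δ * C :=
  tsum_neighborSet_le _ _ C fun _ => hF _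

theorem nbrSum_coe (φ : BPRGraph Δ → BPRGraph Δ) (F : BGr Δ → NNReal) (q : Gr Δ) :
    nbrSum φ (fun b => F b) q =
      ENNReal.ofReal (∑' p : (Quotient.out q).G.neighborSet (Quotient.out q).root,
        (F (mkB (φ ((Quotient.out q).bi p.1 p.2))) : ℝ)) := by
  have := ((Quotient.out q).degbd (Quotient.out q).root).1.fintype
  rw [nbrSum, tsum_fintype, tsum_fintype,
    ENNReal.ofReal_sum_of_nonneg fun _ _ => NNReal.coe_nonneg _]
  simp

/-- Neighbour sums of continuous functions are continuous. -/
theorem continuous_nbrSum [MetricSpace (Gr Δ)] (hdist : ∀ a b : Gr Δ, dist a b = rdist a b)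
    [MetricSpace (BGr Δ)] (hbdist : ∀ a b : BGr Δ, dist a b = brdist a b)
    {φ : BPRGraph Δ → BPRGraph Δ} (hφ : IsLocal φ) {F : BGr Δ → NNReal} (hF : Continuous F) :
    Continuous fun q : Gr Δ => nbrSum φ (fun b => F b) q := by
  simp_rw [nbrSum_coe]
  refine ENNReal.continuous_ofReal.comp (Metric.continuous_iff.2 fun q ε hε => ?_)
  have := ((Quotient.out q).degbd (Quotient.out q).root).1.fintype
  let ε' : ℝ := ε / (Fintype.card ((Quotient.out q).G.neighborSet (Quotient.out q).root) + 1)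
  have hε' : 0 < ε' := by positivity
  have hpow : Tendsto (fun r : ℕ => 2 * (1 / 2 : ℝ) ^ r) atTop (𝓝 0) := by
    simpa using (tendsto_pow_atTop_nhds_zero_of_lt_one (r := (1 / 2 : ℝ))
      (by norm_num) (by norm_num)).const_mul 2
  have hev : ∀ᶠ r : ℕ in atTop, ∀ p : (Quotient.out q).G.neighborSet (Quotient.out q).root,
      ∀ b, Dist.dist b (mkB (φ ((Quotient.out q).bi p.1 p.2))) ≤ 2 * (1 / 2) ^ r →
        Dist.dist (F b : ℝ) (F (mkB (φ ((Quotient.out q).bi p.1 p.2)))) < ε' := by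
    rw [eventually_all]
    intro p
    obtain ⟨δ, hδ, h⟩ := Metric.continuous_iff.1 (NNReal.continuous_coe.comp hF)
      (mkB (φ ((Quotient.out q).bi p.1 p.2))) ε' hε'
    filter_upwards [hpow.eventually_lt_const hδ] with r hr b hb
    exact h b (hb.trans_lt hr)
  obtain ⟨r, hr, hr1⟩ := (hev.and (eventually_ge_atTop 1)).exists
  refine ⟨(1 / 2) ^ (r + 1), by positivity, fun q' hq' => ?_⟩
  have := ((Quotient.out q').degbd (Quotient.out q').root).1.fintype
  rw [_root_.dist_comm, ← mkG_out q, ← mkG_out q'] at hq'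
  obtain ⟨t, ht, hb⟩ := ball_equiv_of_dist_lt hdist hq'
  obtain ⟨σ, hσ⟩ := hφ _ _ r t ht hb
  rw [tsum_fintype, tsum_fintype, ← σ.sum_comp]
  refine (dist_sum_sum_le_of_le _ fun p _ => (hr p _ ?_).le).trans_lt ?_
  · rw [_root_.dist_comm]
    exact BPRGraph.dist_le_of_ball_equiv hbdist hr1 (hσ p)
  · rw [Finset.sum_const, Finset.card_univ, nsmul_eq_mul]
    have hcard : ε' * (Fintype.card ((Quotient.out q).G.neighborSet (Quotient.out q).root) + 1)
      = ε := div_mul_cancel₀ _ (by positivity)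
    linarith

/-- Integrals of neighbour sums of bounded continuous functions pass to weak limits. -/
theorem tendsto_lintegral_nbrSum [MetricSpace (Gr Δ)] [MeasurableSpace (Gr Δ)]
    [BorelSpace (Gr Δ)] [MetricSpace (BGr Δ)] (hdist : ∀ a b : Gr Δ, dist a b = rdist a b)
    (hbdist : ∀ a b : BGr Δ, dist a b = brdist a b)
    {φ : BPRGraph Δ → BPRGraph Δ} (hφ : IsLocal φ) {μn : ℕ → Measure (Gr Δ)} {μ : Measure (Gr Δ)}
    [∀ n, IsFiniteMeasure (μn n)] [IsFiniteMeasure μ] (h : WeakConv μn μ)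
    (F : BoundedContinuousFunction (BGr Δ) NNReal) :
    Tendsto (fun n => ∫⁻ q, nbrSum φ (fun b => F b) q ∂(μn n)) atTop
      (𝓝 (∫⁻ q, nbrSum φ (fun b => F b) q ∂μ)) := by
  have hle : ∀ q, nbrSum φ (fun b => F b) q ≤ Δ * (nndist 0 F : ℝ≥0∞) := fun q =>
    nbrSum_le φ (fun b => ENNReal.coe_le_coe.2 (F.apply_le_nndist_zero b)) q
  have hbound : (Δ : ℝ≥0∞) * (nndist 0 F : ℝ≥0∞) < ⊤ :=
    ENNReal.mul_lt_top (ENNReal.natCast_lt_top _) ENNReal.coe_lt_top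
  have hcont := continuous_nbrSum hdist hbdist hφ F.continuous
  have hint : ∀ ν : Measure (Gr Δ), IsFiniteMeasure ν →
      ∫ q, (nbrSum φ (fun b => F b) q).toReal ∂ν =
        (∫⁻ q, nbrSum φ (fun b => F b) q ∂ν).toReal := fun ν _ =>
    integral_toReal hcont.measurable.aemeasurable
      (ae_of_all _ fun q => (hle q).trans_lt hbound)
  have hfin : ∀ ν : Measure (Gr Δ), IsFiniteMeasure ν →
      ∫⁻ q, nbrSum φ (fun b => F b) q ∂ν ≠ ⊤ := fun ν _ => by
    refine ((lintegral_mono hle).trans_lt ?_).ne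
    rw [lintegral_const]
    exact ENNReal.mul_lt_top hbound (measure_lt_top _ _)
  have := h (fun q => (nbrSum φ (fun b => F b) q).toReal)
    (continuous_iff_continuousAt.2 fun q => (ENNReal.continuousAt_toReal
      ((hle q).trans_lt hbound).ne).comp hcont.continuousAt)
  rw [hint μ inferInstance] at this
  simp_rw [fun n => hint (μn n) inferInstance] at this
  exact (ENNReal.tendsto_toReal_iff (fun n => hfin _ inferInstance) (hfin _ inferInstance)).1 this

variable [MeasurableSpace (BGr Δ)]

/-- The sum of the Dirac masses at the classes of `φ (G, o, x)`, for `x` a neighbour of the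
root `o`. -/
noncomputable def nbrKer (φ : BPRGraph Δ → BPRGraph Δ) (q : Gr Δ) : Measure (BGr Δ) :=
  Measure.sum fun p : (Quotient.out q).G.neighborSet (Quotient.out q).root =>
    Measure.dirac (mkB (φ ((Quotient.out q).bi p.1 p.2)))

theorem lintegral_nbrKer (φ : BPRGraph Δ → BPRGraph Δ) {F : BGr Δ → ℝ≥0∞} (hF : Measurable F)
    (q : Gr Δ) : ∫⁻ b, F b ∂(nbrKer φ q) = nbrSum φ F q := by
  simp_rw [nbrKer, lintegral_sum_measure, lintegral_dirac' _ hF, nbrSum]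

theorem nbrKer_univ_le (φ : BPRGraph Δ → BPRGraph Δ) (q : Gr Δ) :
    nbrKer φ q Set.univ ≤ Δ := by
  rw [← lintegral_one, lintegral_nbrKer φ measurable_const]
  simpa using nbrSum_le φ (F := fun _ => 1) (C := 1) (fun _ => le_rfl) q

instance (φ : BPRGraph Δ → BPRGraph Δ) (q : Gr Δ) : IsFiniteMeasure (nbrKer φ q) :=
  ⟨(nbrKer_univ_le φ q).trans_lt (ENNReal.natCast_lt_top _)⟩

variable [MetricSpace (Gr Δ)] [MetricSpace (BGr Δ)] [BorelSpace (BGr Δ)]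
  [MeasurableSpace (Gr Δ)] [BorelSpace (Gr Δ)]

theorem measurable_nbrKer (hdist : ∀ a b : Gr Δ, dist a b = rdist a b)
    (hbdist : ∀ a b : BGr Δ, dist a b = brdist a b)
    {φ : BPRGraph Δ → BPRGraph Δ} (hφ : IsLocal φ) : Measurable (nbrKer φ) := by
  have key : ∀ K : Set (BGr Δ), IsClosed K → Measurable fun q => nbrKer φ q K := by
    intro K hK
    refine measurable_of_tendsto_metrizable (f := fun n q => ∫⁻ b, hK.apprSeq n b ∂(nbrKer φ q))
      (fun n => ?_) (tendsto_pi_nhds.2 fun q =>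
        HasOuterApproxClosed.tendsto_lintegral_apprSeq hK (nbrKer φ q))
    simp_rw [lintegral_nbrKer φ (hK.apprSeq n).continuous.measurable.coe_nnreal_ennreal]
    exact (continuous_nbrSum hdist hbdist hφ (hK.apprSeq n).continuous).measurable
  exact Measurable.measure_of_isPiSystem
    ((BorelSpace.measurable_eq (α := BGr Δ)).trans borel_eq_generateFrom_isClosed)
    isPiSystem_isClosed key (key _ isClosed_univ)

theorem isFiniteMeasure_bind_nbrKer (hdist : ∀ a b : Gr Δ, dist a b = rdist a b)
    (hbdist : ∀ a b : BGr Δ, dist a b = brdist a b)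
    {φ : BPRGraph Δ → BPRGraph Δ} (hφ : IsLocal φ) (μ : Measure (Gr Δ)) [IsFiniteMeasure μ] :
    IsFiniteMeasure (μ.bind (nbrKer φ)) := by
  refine ⟨?_⟩
  rw [Measure.bind_apply MeasurableSet.univ (measurable_nbrKer hdist hbdist hφ).aemeasurable]
  refine (lintegral_mono (nbrKer_univ_le φ)).trans_lt ?_
  rw [lintegral_const]
  exact ENNReal.mul_lt_top (ENNReal.natCast_lt_top _) (measure_lt_top _ _)

theorem lintegral_bind_nbrKer (hdist : ∀ a b : Gr Δ, dist a b = rdist a b)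
    (hbdist : ∀ a b : BGr Δ, dist a b = brdist a b)
    {φ : BPRGraph Δ → BPRGraph Δ} (hφ : IsLocal φ) (μ : Measure (Gr Δ)) {F : BGr Δ → ℝ≥0∞}
    (hF : Measurable F) : ∫⁻ b, F b ∂(μ.bind (nbrKer φ)) = ∫⁻ q, nbrSum φ F q ∂μ := by
  rw [Measure.lintegral_bind (measurable_nbrKer hdist hbdist hφ).aemeasurable hF.aemeasurable]
  simp_rw [lintegral_nbrKer φ hF]

end Kernel

/-- Weak limits of unimodular probability measures on `Gr` are unimodular. -/
theorem weak_limit_unimodular (Δ : ℕ)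
    [MetricSpace (Gr Δ)] (hdist : ∀ a b : Gr Δ, dist a b = rdist a b)
    [MeasurableSpace (Gr Δ)] [BorelSpace (Gr Δ)]
    [MetricSpace (BGr Δ)] (hbdist : ∀ a b : BGr Δ, dist a b = brdist a b)
    [MeasurableSpace (BGr Δ)] [BorelSpace (BGr Δ)]
    (μn : ℕ → Measure (Gr Δ)) (μ : Measure (Gr Δ))
    [∀ n, IsProbabilityMeasure (μn n)] [IsProbabilityMeasure μ]
    (hu : ∀ n, Unimodular (μn n)) (h : WeakConv μn μ) :
    Unimodular μ := by
  have := isFiniteMeasure_bind_nbrKer hdist hbdist isLocal_swap μ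
  have key : μ.bind (nbrKer BPRGraph.swap) = μ.bind (nbrKer id) := by
    refine ext_of_forall_lintegral_eq_of_IsFiniteMeasure fun F => ?_
    have hF : Measurable fun b => (F b : ℝ≥0∞) := F.continuous.measurable.coe_nnreal_ennreal
    rw [lintegral_bind_nbrKer hdist hbdist isLocal_swap μ hF,
      lintegral_bind_nbrKer hdist hbdist isLocal_id μ hF]
    refine tendsto_nhds_unique (tendsto_lintegral_nbrSum hdist hbdist isLocal_swap h F) ?_
    refine (tendsto_lintegral_nbrSum hdist hbdist isLocal_id h F).congr fun n => ?_
    exact (hu n _ hF).symm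
  intro F hF
  have h1 := lintegral_bind_nbrKer hdist hbdist isLocal_swap μ hF
  rw [key, lintegral_bind_nbrKer hdist hbdist isLocal_id μ hF] at h1
  exact h1.symm
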